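/- arXiv:2209.00769 — 2 statements merged into one kernel-verified Lean document; each statement's English description precedes it below -/
import Mathlib

section
/- Equivalence of kinetic Campanato and kinetic Hölder seminorms (Lemma 2.1). Let d ≥ 1, α ∈ (0,1], T ∈ (−∞,∞], and let u : ℝ^{1+2d}_T → ℝ be continuous and locally square-integrable. Define the kinetic Campanato seminorm [u]_{𝓛^{2,α}_kin(ℝ^{1+2d}_T)} := sup over r > 0 and z₀ = (t₀,x₀,v₀) with t₀ ≤ T of r^{−α} ( |u − (u)_{Q_r(z₀)}|² )^{1/2}_{Q_r(z₀)}. Then there exists N = N(d,α) > 0 such that: (a) [u]_{𝓛^{2,α}_kin(ℝ^{1+2d}_T)} ≤ N [u]_{kC^α(ℝ^{1+2d}_T)}; and (b) if [u]_{𝓛^{2,α}_kin(ℝ^{1+2d}_T)} < ∞ then [u]_{kC^α(ℝ^{1+2d}_T)} ≤ N [u]_{𝓛^{2,α}_kin(ℝ^{1+2d}_T)}. -/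
open MeasureTheory ENNReal Set

noncomputable section

/-- Euclidean space `ℝ^d`. -/
abbrev Ed (d : ℕ) : Type := EuclideanSpace ℝ (Fin d)

/-- Points `z = (t, x, v) ∈ ℝ × ℝ^d × ℝ^d`. -/
abbrev Pt (d : ℕ) : Type := ℝ × Ed d × Ed d

/-- The kinetic quasi-distance `ρ(z, z₀)`. -/
def kRho {d : ℕ} (z z0 : Pt d) : ℝ :=
  max (|z.1 - z0.1| ^ ((1 : ℝ)/2))
    (max (‖z.2.1 - z0.2.1 + (z.1 - z0.1) • z0.2.2‖ ^ ((1 : ℝ)/3)) ‖z.2.2 - z0.2.2‖)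

/-- The kinetic Hölder seminorm `[u]_{kC^α(G)}` (extended-real valued). -/
def kSemi {d : ℕ} {F : Type*} [NormedAddCommGroup F] (α : ℝ) (G : Set (Pt d))
    (u : Pt d → F) : ℝ≥0∞ :=
  ⨆ (z : Pt d) (_ : z ∈ G) (z' : Pt d) (_ : z' ∈ G) (_ : z ≠ z'),
    ENNReal.ofReal (‖u z - u z'‖ / kRho z z' ^ α)

/-- The sup (`L_∞`) norm over `G`, extended-real valued. -/
def supNorm {d : ℕ} {F : Type*} [NormedAddCommGroup F] (G : Set (Pt d))
    (u : Pt d → F) : ℝ≥0∞ :=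
  ⨆ (z : Pt d) (_ : z ∈ G), (‖u z‖₊ : ℝ≥0∞)

/-- Anisotropic Hölder seminorm `[w]_{C^{α/3,α}_{x,v}(D)}`. -/
def anisoSemi {d : ℕ} {F : Type*} [NormedAddCommGroup F] (α : ℝ) (D : Set (Ed d × Ed d))
    (w : Ed d × Ed d → F) : ℝ≥0∞ :=
  ⨆ (p : Ed d × Ed d) (_ : p ∈ D) (q : Ed d × Ed d) (_ : q ∈ D) (_ : p ≠ q),
    ENNReal.ofReal (‖w p - w q‖ / (‖p.1 - q.1‖ ^ ((1 : ℝ)/3) + ‖p.2 - q.2‖) ^ α)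

/-- The `L_∞ C^{α/3,α}_{x,v}` seminorm over `I × D`. -/
def lixvSemi {d : ℕ} {F : Type*} [NormedAddCommGroup F] (α : ℝ) (I : Set ℝ)
    (D : Set (Ed d × Ed d)) (u : Pt d → F) : ℝ≥0∞ :=
  ⨆ (t : ℝ) (_ : t ∈ I), anisoSemi α D (fun p => u (t, p.1, p.2))

/-- The time interval `(−∞, T)` for `T ∈ (−∞, ∞]`. -/
def slabI (T : EReal) : Set ℝ := {t : ℝ | (t : EReal) < T}

/-- The set `ℝ^{1+2d}_T = (−∞,T) × ℝ^{2d}`. -/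
def slabG (d : ℕ) (T : EReal) : Set (Pt d) := slabI T ×ˢ (Set.univ : Set (Ed d × Ed d))

/-- Classical time derivative `∂_t u`. -/
def Dt {d : ℕ} (u : Pt d → ℝ) (z : Pt d) : ℝ := deriv (fun s => u (s, z.2.1, z.2.2)) z.1

/-- Classical spatial gradient `D_x u`. -/
def Dx {d : ℕ} (u : Pt d → ℝ) (z : Pt d) : Ed d →L[ℝ] ℝ :=
  fderiv ℝ (fun y => u (z.1, y, z.2.2)) z.2.1

/-- Classical velocity gradient `D_v u`. -/
def Dv {d : ℕ} (u : Pt d → ℝ) (z : Pt d) : Ed d →L[ℝ] ℝ :=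
  fderiv ℝ (fun w => u (z.1, z.2.1, w)) z.2.2

/-- Classical velocity Hessian `D²_v u`. -/
def Dvv {d : ℕ} (u : Pt d → ℝ) (z : Pt d) : Ed d →L[ℝ] Ed d →L[ℝ] ℝ :=
  fderiv ℝ (fun w => Dv u (z.1, z.2.1, w)) z.2.2

/-- Transport term `Y u = ∂_t u − v · D_x u`. -/
def Yop {d : ℕ} (u : Pt d → ℝ) (z : Pt d) : ℝ := Dt u z - Dx u z z.2.2

/-- Contraction `a^{ij} B_{ij}`. -/
def contr2 {d : ℕ} (A : Matrix (Fin d) (Fin d) ℝ) (B : Ed d →L[ℝ] Ed d →L[ℝ] ℝ) : ℝ :=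
  ∑ i, ∑ j, A i j * B (EuclideanSpace.single i 1) (EuclideanSpace.single j 1)

/-- KFP operator `P u = ∂_t u − v·D_x u − a^{ij}(z) D_{v_iv_j} u`. -/
def Pop {d : ℕ} (a : Pt d → Matrix (Fin d) (Fin d) ℝ) (u : Pt d → ℝ) (z : Pt d) : ℝ :=
  Yop u z - contr2 (a z) (Dvv u z)

/-- Model KFP operator with `a = a(t)`. -/
def P0op {d : ℕ} (a : ℝ → Matrix (Fin d) (Fin d) ℝ) (u : Pt d → ℝ) (z : Pt d) : ℝ :=
  Yop u z - contr2 (a z.1) (Dvv u z)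

/-- Laplacian in the velocity variable `Δ_v u`. -/
def lapV {d : ℕ} (u : Pt d → ℝ) (z : Pt d) : ℝ :=
  ∑ i, Dvv u z (EuclideanSpace.single i 1) (EuclideanSpace.single i 1)

/-- Fractional Laplacian `(−Δ_x)^{1/3} u`, pointwise integral formula with constant `cd`. -/
def fracLap {d : ℕ} (cd : ℝ) (u : Pt d → ℝ) (z : Pt d) : ℝ :=
  cd * ∫ y : Ed d, (u z - u (z.1, z.2.1 + y, z.2.2)) / ‖y‖ ^ ((d : ℝ) + 2/3)

/-- Hölder seminorm in `x` of a function on `ℝ^d`. -/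
def xSemi {d : ℕ} (β : ℝ) (w : Ed d → ℝ) : ℝ≥0∞ :=
  ⨆ (x : Ed d) (x' : Ed d) (_ : x ≠ x'), ENNReal.ofReal (|w x - w x'| / ‖x - x'‖ ^ β)

/-- `sup_{t ∈ I, v} [u(t,·,v)]_{C^β(ℝ^d)}`. -/
def supXSemi {d : ℕ} (β : ℝ) (I : Set ℝ) (u : Pt d → ℝ) : ℝ≥0∞ :=
  ⨆ (t : ℝ) (_ : t ∈ I) (v : Ed d), xSemi β (fun x => u (t, x, v))

/-- Hölder norm in `x` over a set `A ⊂ ℝ^d`. -/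
def xHolderNorm {d : ℕ} (β : ℝ) (A : Set (Ed d)) (w : Ed d → ℝ) : ℝ≥0∞ :=
  (⨆ (x : Ed d) (_ : x ∈ A), ENNReal.ofReal |w x|) +
    ⨆ (x : Ed d) (_ : x ∈ A) (x' : Ed d) (_ : x' ∈ A) (_ : x ≠ x'),
      ENNReal.ofReal (|w x - w x'| / ‖x - x'‖ ^ β)

/-- Kinetic cylinder `Q_{r,s}(z₀)` (`v`-radius `r`, `x`-radius `s³`). -/
def kCyl {d : ℕ} (r s : ℝ) (z0 : Pt d) : Set (Pt d) :=
  {z : Pt d | z0.1 - r ^ 2 < z.1 ∧ z.1 < z0.1 ∧ ‖z.2.2 - z0.2.2‖ < r ∧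
    ‖z.2.1 - z0.2.1 + (z.1 - z0.1) • z0.2.2‖ < s ^ 3}

/-- Kinetic cylinder `Q_r(z₀)`. -/
def kQ {d : ℕ} (r : ℝ) (z0 : Pt d) : Set (Pt d) := kCyl r r z0

/-- The origin of `ℝ^{1+2d}`. -/
def ptO (d : ℕ) : Pt d := (0, 0, 0)

/-- Mean-square average `(|g|²)^{1/2}_A`. -/
def msq {d : ℕ} {F : Type*} [NormedAddCommGroup F] (A : Set (Pt d)) (g : Pt d → F) : ℝ :=
  Real.sqrt (⨍ z in A, ‖g z‖ ^ 2)

/-- Average `(g)_A`. -/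
def avg {d : ℕ} {F : Type*} [NormedAddCommGroup F] [NormedSpace ℝ F] (A : Set (Pt d))
    (g : Pt d → F) : F :=
  ⨍ z in A, g z

/-- Mean-square oscillation `(|g − (g)_A|²)^{1/2}_A`. -/
def oscL2 {d : ℕ} {F : Type*} [NormedAddCommGroup F] [NormedSpace ℝ F] (A : Set (Pt d))
    (g : Pt d → F) : ℝ :=
  msq A (fun z => g z - avg A g)

/-- `L²` norm over `A`. -/
def l2 {d : ℕ} {F : Type*} [NormedAddCommGroup F] (A : Set (Pt d)) (g : Pt d → F) : ℝ :=
  Real.sqrt (∫ z in A, ‖g z‖ ^ 2)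

/-- Membership in the kinetic Hölder space `kC^{2,α}(I × D)`:
`u ∈ kC^α`, the classical derivatives `D_v u`, `D²_v u`, `Y u` exist,
`Y u ∈ L_∞ C^{α/3,α}_{x,v}` and `[D²_v u]_{kC^α} < ∞`. -/
def kC2mem {d : ℕ} (α : ℝ) (I : Set ℝ) (D : Set (Ed d × Ed d)) (u : Pt d → ℝ) : Prop :=
  supNorm (I ×ˢ D) u < ⊤ ∧ kSemi α (I ×ˢ D) u < ⊤ ∧
  (∀ z ∈ I ×ˢ D, DifferentiableAt ℝ (fun s => u (s, z.2.1, z.2.2)) z.1) ∧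
  (∀ z ∈ I ×ˢ D, DifferentiableAt ℝ (fun y => u (z.1, y, z.2.2)) z.2.1) ∧
  (∀ z ∈ I ×ˢ D, DifferentiableAt ℝ (fun w => u (z.1, z.2.1, w)) z.2.2) ∧
  (∀ z ∈ I ×ˢ D, DifferentiableAt ℝ (fun w => Dv u (z.1, z.2.1, w)) z.2.2) ∧
  supNorm (I ×ˢ D) (Yop u) < ⊤ ∧
  lixvSemi α I D (Yop u) < ⊤ ∧
  kSemi α (I ×ˢ D) (Dvv u) < ⊤

/-- Membership in the anisotropic Hölder space `ℂ^{2,α}(I × D)`: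
the classical derivatives `D_v u`, `D²_v u`, `Y u` exist and
`u, D_v u, D²_v u, Y u ∈ L_∞ C^{α/3,α}_{x,v}(I × D)`. -/
def C2mem {d : ℕ} (α : ℝ) (I : Set ℝ) (D : Set (Ed d × Ed d)) (u : Pt d → ℝ) : Prop :=
  (∀ z ∈ I ×ˢ D, DifferentiableAt ℝ (fun s => u (s, z.2.1, z.2.2)) z.1) ∧
  (∀ z ∈ I ×ˢ D, DifferentiableAt ℝ (fun y => u (z.1, y, z.2.2)) z.2.1) ∧
  (∀ z ∈ I ×ˢ D, DifferentiableAt ℝ (fun w => u (z.1, z.2.1, w)) z.2.2) ∧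
  (∀ z ∈ I ×ˢ D, DifferentiableAt ℝ (fun w => Dv u (z.1, z.2.1, w)) z.2.2) ∧
  supNorm (I ×ˢ D) u < ⊤ ∧ lixvSemi α I D u < ⊤ ∧
  supNorm (I ×ˢ D) (Dv u) < ⊤ ∧ lixvSemi α I D (Dv u) < ⊤ ∧
  supNorm (I ×ˢ D) (Dvv u) < ⊤ ∧ lixvSemi α I D (Dvv u) < ⊤ ∧
  supNorm (I ×ˢ D) (Yop u) < ⊤ ∧ lixvSemi α I D (Yop u) < ⊤

/-- Ellipticity and boundedness of a coefficient matrix: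
`a^{ij} ξ_i ξ_j ≥ δ|ξ|²` and `|a| ≤ δ⁻¹`. -/
def elliptic {d : ℕ} (δ : ℝ) (A : Matrix (Fin d) (Fin d) ℝ) : Prop :=
  (∀ ξ : Ed d, δ * ‖ξ‖ ^ 2 ≤ ∑ i, ∑ j, A i j * ξ i * ξ j) ∧ (∀ i j, |A i j| ≤ δ⁻¹)

/-- Iterated classical mixed derivative `D_v^m D_x^l u`. -/
def Dmix {d : ℕ} (l m : ℕ) (u : Pt d → ℝ) (z : Pt d) :
    ContinuousMultilinearMap ℝ (fun _ : Fin m => Ed d)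
      (ContinuousMultilinearMap ℝ (fun _ : Fin l => Ed d) ℝ) :=
  iteratedFDeriv ℝ m (fun w => iteratedFDeriv ℝ l (fun y => u (z.1, y, w)) z.2.1) z.2.2

/-- Time derivative of the mixed derivative: `∂_t D_x^l D_v^m u`. -/
def DtMix {d : ℕ} (l m : ℕ) (u : Pt d → ℝ) (z : Pt d) :
    ContinuousMultilinearMap ℝ (fun _ : Fin m => Ed d)
      (ContinuousMultilinearMap ℝ (fun _ : Fin l => Ed d) ℝ) :=
  deriv (fun s => Dmix l m u (s, z.2.1, z.2.2)) z.1

/-- `∂_t` for functions of `(t,v)`. -/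
def Dt2 {d : ℕ} (w : ℝ × Ed d → ℝ) (t : ℝ) (v : Ed d) : ℝ := deriv (fun s => w (s, v)) t

/-- `D_v` for functions of `(t,v)`. -/
def Dv2 {d : ℕ} (w : ℝ × Ed d → ℝ) (t : ℝ) (v : Ed d) : Ed d →L[ℝ] ℝ :=
  fderiv ℝ (fun y => w (t, y)) v

/-- `D²_v` for functions of `(t,v)`. -/
def Dvv2 {d : ℕ} (w : ℝ × Ed d → ℝ) (t : ℝ) (v : Ed d) : Ed d →L[ℝ] Ed d →L[ℝ] ℝ :=
  fderiv ℝ (fun y => Dv2 w t y) v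

/-- The kinetic scaling `z ↦ z̃ = (r²t + t₀, r³x + x₀ − r²t v₀, rv + v₀)`. -/
def kScale {d : ℕ} (r : ℝ) (z0 z : Pt d) : Pt d :=
  (r ^ 2 * z.1 + z0.1, (r ^ 3) • z.2.1 + z0.2.1 - (r ^ 2 * z.1) • z0.2.2, r • z.2.2 + z0.2.2)

/-- Kinetic Campanato seminorm. -/
def campSemi {d : ℕ} (α : ℝ) (T : EReal) (u : Pt d → ℝ) : ℝ≥0∞ :=
  ⨆ (r : ℝ) (_ : 0 < r) (z0 : Pt d) (_ : (z0.1 : EReal) ≤ T),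
    ENNReal.ofReal (oscL2 (kQ r z0) u / r ^ α)

end

open Filter Topology

section Average

variable {X : Type*} [MeasurableSpace X] {μ : Measure X} {A B : Set X} {f : X → ℝ}

theorem integrableOn_of_sq (hA : μ A ≠ ∞) (hf : AEStronglyMeasurable f (μ.restrict A))
    (hf2 : IntegrableOn (fun x => f x ^ 2) A μ) : IntegrableOn f A μ := by
  refine Integrable.mono' (hf2.add (integrableOn_const hA (C := (1 : ℝ)))) hf ?_
  filter_upwards with x
  rw [Real.norm_eq_abs, Pi.add_apply, ← sq_abs]
  nlinarith [sq_nonneg (|f x| - 1), abs_nonneg (f x)]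

theorem integrableOn_sub_const_sq (hA : μ A ≠ ∞) (hf : IntegrableOn f A μ)
    (hf2 : IntegrableOn (fun x => f x ^ 2) A μ) (c : ℝ) :
    IntegrableOn (fun x => (f x - c) ^ 2) A μ := by
  have h := (hf2.sub (hf.const_mul (2 * c))).add (integrableOn_const hA (C := c ^ 2))
  refine h.congr (Eventually.of_forall fun x => ?_)
  simp only [Pi.add_apply, Pi.sub_apply]
  ring

/-- Averages over nested sets of comparable measure differ by at most a multiple of the
mean-square oscillation over the larger one. -/
theorem abs_setAverage_sub_le (hAB : A ⊆ B) (hA : 0 < μ.real A) (hB : μ B ≠ ∞) {M : ℝ}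
    (hM : μ.real B ≤ M * μ.real A) (hf : IntegrableOn f B μ)
    (hf2 : IntegrableOn (fun x => f x ^ 2) B μ) :
    |(⨍ x in A, f x ∂μ) - ⨍ x in B, f x ∂μ| ≤
      √M * √(⨍ x in B, ‖f x - ⨍ y in B, f y ∂μ‖ ^ 2 ∂μ) := by
  set c := ⨍ x in B, f x ∂μ
  have hA0 : μ A ≠ 0 := fun h => by simp [measureReal_def, h] at hA
  have hAf : μ A ≠ ∞ := ne_top_of_le_ne_top hB (measure_mono hAB)
  have hBpos : 0 < μ.real B := hA.trans_le (measureReal_mono hAB hB)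
  have hM0 : 0 ≤ M := by
    by_contra h
    nlinarith
  have hi2 := integrableOn_sub_const_sq hB hf hf2 c
  have hjensen : ((⨍ x in A, f x ∂μ) - c) ^ 2 ≤ ⨍ x in A, (f x - c) ^ 2 ∂μ := by
    have hconv : ConvexOn ℝ univ fun y : ℝ => (y - c) ^ 2 := by
      simpa [Function.comp_def, sub_eq_add_neg] using
        (Even.convexOn_pow (𝕜 := ℝ) even_two).translate_left (-c)
    exact hconv.map_set_average_le (by fun_prop) isClosed_univ hA0 hAf (by simp)
      (hf.mono_set hAB) (hi2.mono_set hAB)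
  have hmono : ⨍ x in A, (f x - c) ^ 2 ∂μ ≤ M * ⨍ x in B, (f x - c) ^ 2 ∂μ := by
    have hint : ∫ x in A, (f x - c) ^ 2 ∂μ ≤ ∫ x in B, (f x - c) ^ 2 ∂μ :=
      setIntegral_mono_set hi2 (Eventually.of_forall fun x => sq_nonneg _)
        (Eventually.of_forall hAB)
    have hpos : 0 ≤ ∫ x in B, (f x - c) ^ 2 ∂μ := integral_nonneg fun x => sq_nonneg _
    rw [setAverage_eq, setAverage_eq, smul_eq_mul, smul_eq_mul, ← mul_assoc]
    refine mul_le_mul ?_ hint (integral_nonneg fun x => sq_nonneg _) (by positivity)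
    rw [← div_eq_mul_inv, le_div_iff₀ hBpos, inv_mul_le_iff₀ hA]
    linarith
  rw [← Real.sqrt_mul hM0]
  refine Real.abs_le_sqrt (hjensen.trans (hmono.trans_eq ?_))
  simp only [Real.norm_eq_abs, sq_abs]

end Average

section Cylinders

variable {d : ℕ}

theorem isOpen_kQ (r : ℝ) (z0 : Pt d) : IsOpen (kQ r z0) := by
  simp only [kQ, kCyl, ofPred_and]
  refine (isOpen_lt ?_ ?_).inter ((isOpen_lt ?_ ?_).inter ((isOpen_lt ?_ ?_).inter
    (isOpen_lt ?_ ?_))) <;> fun_prop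

/-- The volume of a kinetic cylinder scales with the homogeneous dimension `2 + 4d`. -/
theorem volume_kQ {r : ℝ} (hr : 0 < r) (z0 : Pt d) :
    volume (kQ r z0) = ENNReal.ofReal (r ^ (2 + 4 * d)) *
      (volume (Metric.ball (0 : Ed d) 1) * volume (Metric.ball (0 : Ed d) 1)) := by
  have hslice : ∀ t : ℝ, volume (Prod.mk t ⁻¹' kQ r z0) =
      (Ioo (z0.1 - r ^ 2) z0.1).indicator (fun _ => ENNReal.ofReal (r ^ (4 * d)) *
        (volume (Metric.ball (0 : Ed d) 1) * volume (Metric.ball (0 : Ed d) 1))) t := by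
    intro t
    by_cases ht : t ∈ Ioo (z0.1 - r ^ 2) z0.1
    · have hset : Prod.mk t ⁻¹' kQ r z0 =
          Metric.ball (z0.2.1 - (t - z0.1) • z0.2.2) (r ^ 3) ×ˢ Metric.ball z0.2.2 r := by
        ext ⟨x, v⟩
        simp only [kQ, kCyl, mem_preimage, mem_ofPred_eq, mem_prod, Metric.mem_ball,
          dist_eq_norm, sub_sub_eq_add_sub, add_sub_right_comm]
        exact ⟨fun h => ⟨h.2.2.2, h.2.2.1⟩, fun h => ⟨ht.1, ht.2, h.2, h.1⟩⟩
      rw [hset, Measure.volume_eq_prod, Measure.prod_prod, indicator_of_mem ht,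
        ← mul_one (r ^ 3), Measure.addHaar_ball_mul_of_pos _ _ (by positivity) 1,
        ← mul_one r, Measure.addHaar_ball_mul_of_pos _ _ hr 1, mul_one, finrank_euclideanSpace,
        Fintype.card_fin, mul_mul_mul_comm, ← ENNReal.ofReal_mul (by positivity)]
      congr 2
      ring
    · rw [indicator_of_notMem ht]
      convert measure_empty (μ := (volume : Measure (Ed d × Ed d)))
      ext ⟨x, v⟩
      simp only [kQ, kCyl, mem_preimage, mem_ofPred_eq, mem_empty_iff_false, iff_false]
      exact fun h => ht ⟨h.1, h.2.1⟩
  rw [Measure.volume_eq_prod, Measure.prod_apply (isOpen_kQ r z0).measurableSet,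
    lintegral_congr hslice, lintegral_indicator measurableSet_Ioo, setLIntegral_const,
    Real.volume_Ioo, _root_.sub_sub_cancel, mul_right_comm, ← ENNReal.ofReal_mul (by positivity)]
  congr 2
  ring

theorem volume_kQ_ne_top {r : ℝ} (hr : 0 < r) (z0 : Pt d) : volume (kQ r z0) ≠ ∞ := by
  rw [volume_kQ hr]
  exact ENNReal.mul_ne_top ENNReal.ofReal_ne_top
    (ENNReal.mul_ne_top measure_ball_lt_top.ne measure_ball_lt_top.ne)

theorem volume_kQ_ne_zero {r : ℝ} (hr : 0 < r) (z0 : Pt d) : volume (kQ r z0) ≠ 0 := by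
  rw [volume_kQ hr]
  have hball := (Metric.measure_ball_pos volume (0 : Ed d) one_pos).ne'
  exact mul_ne_zero (by simpa using by positivity) (mul_ne_zero hball hball)

theorem volume_real_kQ_pos {r : ℝ} (hr : 0 < r) (z0 : Pt d) : 0 < volume.real (kQ r z0) :=
  ENNReal.toReal_pos (volume_kQ_ne_zero hr z0) (volume_kQ_ne_top hr z0)

theorem volume_real_kQ_two_mul {r : ℝ} (hr : 0 < r) (z1 z2 : Pt d) :
    volume.real (kQ (2 * r) z2) = 2 ^ (2 + 4 * d) * volume.real (kQ r z1) := by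
  rw [measureReal_def, measureReal_def, volume_kQ hr, volume_kQ (by positivity), mul_pow,
    ENNReal.toReal_mul, ENNReal.toReal_mul (a := ENNReal.ofReal (r ^ _)),
    ENNReal.toReal_ofReal (by positivity), ENNReal.toReal_ofReal (by positivity)]
  ring

theorem kQ_subset_slabG {T : EReal} {z0 : Pt d} (hz : (z0.1 : EReal) ≤ T) (r : ℝ) :
    kQ r z0 ⊆ slabG d T := fun _ h =>
  ⟨lt_of_lt_of_le (EReal.coe_lt_coe_iff.2 h.2.1) hz, mem_univ _⟩

theorem isOpen_slabG (d : ℕ) (T : EReal) : IsOpen (slabG d T) :=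
  (isOpen_lt continuous_coe_real_ereal continuous_const).prod isOpen_univ

theorem kQ_subset_kQ_two_mul {r : ℝ} {z1 z2 : Pt d} (ht : z1.1 ≤ z2.1)
    (ht' : z2.1 - z1.1 ≤ r ^ 2) (hv : ‖z1.2.2 - z2.2.2‖ ≤ r)
    (hx : ‖z1.2.1 - z2.2.1 + (z1.1 - z2.1) • z2.2.2‖ ≤ 2 * r ^ 3) :
    kQ r z1 ⊆ kQ (2 * r) z2 := by
  rintro ⟨t, x, v⟩ ⟨h1, h2, h3, h4⟩
  have hr : 0 < r := (norm_nonneg _).trans_lt h3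
  dsimp only at h1 h2 h3 h4
  refine ⟨by dsimp only; nlinarith, h2.trans_le ht, ?_, ?_⟩
  · calc ‖v - z2.2.2‖ ≤ ‖v - z1.2.2‖ + ‖z1.2.2 - z2.2.2‖ := norm_sub_le_norm_sub_add_norm_sub ..
      _ < 2 * r := by linarith
  · have hsplit : x - z2.2.1 + (t - z2.1) • z2.2.2 =
        (x - z1.2.1 + (t - z1.1) • z1.2.2) + (z1.2.1 - z2.2.1 + (z1.1 - z2.1) • z2.2.2)
          - (t - z1.1) • (z1.2.2 - z2.2.2) := by
      module
    have hdrift : ‖(t - z1.1) • (z1.2.2 - z2.2.2)‖ ≤ r ^ 2 * r := by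
      rw [norm_smul]
      refine mul_le_mul ?_ hv (norm_nonneg _) (by positivity)
      rw [Real.norm_eq_abs, abs_le]
      constructor <;> nlinarith
    dsimp only
    rw [hsplit]
    refine (norm_sub_le _ _).trans_lt ?_
    have := norm_add_le (x - z1.2.1 + (t - z1.1) • z1.2.2)
      (z1.2.1 - z2.2.1 + (z1.1 - z2.1) • z2.2.2)
    nlinarith [pow_pos hr 3]

theorem kRho_nonneg (z z' : Pt d) : 0 ≤ kRho z z' :=
  le_max_of_le_left (Real.rpow_nonneg (abs_nonneg _) _)

theorem abs_time_sub_le_kRho_sq (z z' : Pt d) : |z.1 - z'.1| ≤ kRho z z' ^ 2 := by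
  calc |z.1 - z'.1| = (|z.1 - z'.1| ^ (((2 : ℕ) : ℝ)⁻¹)) ^ 2 :=
        (Real.rpow_inv_natCast_pow (abs_nonneg _) two_ne_zero).symm
    _ ≤ kRho z z' ^ 2 := by
        gcongr
        rw [Nat.cast_ofNat, ← one_div]
        exact le_max_left _ _

theorem norm_position_sub_le_kRho_cube (z z' : Pt d) :
    ‖z.2.1 - z'.2.1 + (z.1 - z'.1) • z'.2.2‖ ≤ kRho z z' ^ 3 := by
  calc ‖z.2.1 - z'.2.1 + (z.1 - z'.1) • z'.2.2‖
      = (‖z.2.1 - z'.2.1 + (z.1 - z'.1) • z'.2.2‖ ^ (((3 : ℕ) : ℝ)⁻¹)) ^ 3 :=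
        (Real.rpow_inv_natCast_pow (norm_nonneg _) three_ne_zero).symm
    _ ≤ kRho z z' ^ 3 := by
        gcongr
        rw [Nat.cast_ofNat, ← one_div]
        exact le_max_of_le_right (le_max_left _ _)

theorem norm_velocity_sub_le_kRho (z z' : Pt d) : ‖z.2.2 - z'.2.2‖ ≤ kRho z z' :=
  le_max_of_le_right (le_max_right _ _)

theorem kRho_le {z z' : Pt d} {R : ℝ} (hR : 0 ≤ R) (ht : |z.1 - z'.1| ≤ R ^ 2)
    (hx : ‖z.2.1 - z'.2.1 + (z.1 - z'.1) • z'.2.2‖ ≤ R ^ 3) (hv : ‖z.2.2 - z'.2.2‖ ≤ R) :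
    kRho z z' ≤ R := by
  refine max_le ?_ (max_le ?_ hv)
  · refine (Real.rpow_le_rpow (abs_nonneg _) ht (by norm_num)).trans_eq ?_
    simpa using Real.pow_rpow_inv_natCast hR two_ne_zero
  · refine (Real.rpow_le_rpow (norm_nonneg _) hx (by norm_num)).trans_eq ?_
    simpa using Real.pow_rpow_inv_natCast hR three_ne_zero

theorem kRho_pos {z z' : Pt d} (h : z ≠ z') : 0 < kRho z z' := by
  refine (kRho_nonneg z z').lt_of_ne fun h0 => h ?_
  have ht := abs_time_sub_le_kRho_sq z z'
  have hx := norm_position_sub_le_kRho_cube z z'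
  have hv := norm_velocity_sub_le_kRho z z'
  rw [← h0] at ht hx hv
  have ht' : z.1 - z'.1 = 0 := by simpa using ht
  rw [ht'] at hx
  refine Prod.ext (sub_eq_zero.1 ht') (Prod.ext (sub_eq_zero.1 ?_) (sub_eq_zero.1 ?_))
  · simpa using hx
  · simpa using hv

theorem kRho_le_of_mem_kQ {r : ℝ} {z0 z z' : Pt d} (hz : z ∈ kQ r z0) (hz' : z' ∈ kQ r z0) :
    kRho z z' ≤ 2 * r := by
  obtain ⟨h1, h2, h3, h4⟩ := hz
  obtain ⟨h1', h2', h3', h4'⟩ := hz'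
  have hr : 0 < r := (norm_nonneg _).trans_lt h3
  have hv : ‖z.2.2 - z'.2.2‖ ≤ 2 * r := by
    have := norm_sub_le_norm_sub_add_norm_sub z.2.2 z0.2.2 z'.2.2
    rw [norm_sub_rev z0.2.2] at this
    linarith
  have ht : |z.1 - z'.1| ≤ r ^ 2 := by
    rw [abs_le]
    constructor <;> linarith
  refine kRho_le (by positivity) (by nlinarith) ?_ hv
  have hsplit : z.2.1 - z'.2.1 + (z.1 - z'.1) • z'.2.2 =
      (z.2.1 - z0.2.1 + (z.1 - z0.1) • z0.2.2) - (z'.2.1 - z0.2.1 + (z'.1 - z0.1) • z0.2.2)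
        + (z.1 - z'.1) • (z'.2.2 - z0.2.2) := by
    module
  have hdrift : ‖(z.1 - z'.1) • (z'.2.2 - z0.2.2)‖ ≤ r ^ 2 * r := by
    rw [norm_smul]
    exact mul_le_mul ht h3'.le (norm_nonneg _) (by positivity)
  rw [hsplit]
  refine (norm_add_le _ _).trans ?_
  have := norm_sub_le (z.2.1 - z0.2.1 + (z.1 - z0.1) • z0.2.2)
    (z'.2.1 - z0.2.1 + (z'.1 - z0.1) • z0.2.2)
  nlinarith [pow_pos hr 3]

/-- Small kinetic cylinders shrink to their vertex. -/
theorem exists_forall_kQ_subset {z0 : Pt d} {U : Set (Pt d)} (hU : U ∈ 𝓝 z0) :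
    ∃ s > 0, ∀ r, r < s → kQ r z0 ⊆ U := by
  obtain ⟨ε, hε, hball⟩ := Metric.mem_nhds_iff.1 hU
  have hlim : Tendsto (fun r : ℝ => r ^ 2 + r + (r ^ 3 + r ^ 2 * ‖z0.2.2‖)) (𝓝 0) (𝓝 0) := by
    refine Continuous.tendsto' (by fun_prop) _ _ (by simp)
  obtain ⟨s, hs, hsmall⟩ := Metric.eventually_nhds_iff.1 (hlim.eventually (gt_mem_nhds hε))
  refine ⟨s, hs, fun r hr z hz => hball ?_⟩
  obtain ⟨h1, h2, h3, h4⟩ := hz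
  have hr0 : 0 < r := (norm_nonneg _).trans_lt h3
  have hlt := hsmall (y := r) (by rwa [Real.dist_eq, sub_zero, abs_of_pos hr0])
  have ht : |z.1 - z0.1| ≤ r ^ 2 := by
    rw [abs_le]
    constructor <;> nlinarith
  have hx : ‖z.2.1 - z0.2.1‖ ≤ r ^ 3 + r ^ 2 * ‖z0.2.2‖ := by
    calc ‖z.2.1 - z0.2.1‖
        = ‖(z.2.1 - z0.2.1 + (z.1 - z0.1) • z0.2.2) - (z.1 - z0.1) • z0.2.2‖ := by
          rw [add_sub_cancel_right]
      _ ≤ r ^ 3 + r ^ 2 * ‖z0.2.2‖ := by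
          refine (norm_sub_le _ _).trans (add_le_add h4.le ?_)
          rw [norm_smul]
          gcongr
          exact ht
  have h0 : 0 ≤ r ^ 3 + r ^ 2 * ‖z0.2.2‖ := by positivity
  rw [Metric.mem_ball, Prod.dist_eq, Prod.dist_eq, Real.dist_eq, dist_eq_norm, dist_eq_norm]
  refine max_lt ?_ (max_lt ?_ ?_) <;> nlinarith [sq_nonneg r]

end Cylinders

section Campanato

variable {d : ℕ} {α : ℝ} {T : EReal} {u : Pt d → ℝ}

theorem abs_avg_sub_le {r : ℝ} (hr : 0 < r) {z0 : Pt d} {c ε : ℝ}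
    (hu : IntegrableOn u (kQ r z0)) (h : ∀ z ∈ kQ r z0, |u z - c| ≤ ε) :
    |avg (kQ r z0) u - c| ≤ ε :=
  (convex_closedBall c ε).set_average_mem Metric.isClosed_closedBall (volume_kQ_ne_zero hr z0)
    (volume_kQ_ne_top hr z0)
    (ae_restrict_of_forall_mem (isOpen_kQ r z0).measurableSet h) hu

theorem oscL2_kQ_le {r : ℝ} (hr : 0 < r) {z0 : Pt d} {D : ℝ} (hD : 0 ≤ D)
    (hu : IntegrableOn u (kQ r z0)) (hu2 : IntegrableOn (fun z => u z ^ 2) (kQ r z0))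
    (h : ∀ z ∈ kQ r z0, ∀ z' ∈ kQ r z0, |u z - u z'| ≤ D) :
    oscL2 (kQ r z0) u ≤ D := by
  have hdev : ∀ z ∈ kQ r z0, |u z - avg (kQ r z0) u| ≤ D := fun z hz => by
    rw [abs_sub_comm]
    exact abs_avg_sub_le hr hu fun z' hz' => h z' hz' z hz
  have hint := integrableOn_sub_const_sq (volume_kQ_ne_top hr z0) hu hu2 (avg (kQ r z0) u)
  have hmem : ⨍ z in kQ r z0, (u z - avg (kQ r z0) u) ^ 2 ∈ Iic (D ^ 2) :=
    (convex_Iic _).set_average_mem isClosed_Iic (volume_kQ_ne_zero hr z0) (volume_kQ_ne_top hr z0)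
      (ae_restrict_of_forall_mem (isOpen_kQ r z0).measurableSet fun z hz =>
        sq_le_sq' (abs_le.1 (hdev z hz)).1 (abs_le.1 (hdev z hz)).2) hint
  refine Real.sqrt_le_iff.2 ⟨hD, ?_⟩
  simpa only [Real.norm_eq_abs, sq_abs, mem_Iic] using hmem

theorem abs_sub_le_kSemi {G : Set (Pt d)} (hfin : kSemi α G u ≠ ∞) {z z' : Pt d}
    (hz : z ∈ G) (hz' : z' ∈ G) : |u z - u z'| ≤ (kSemi α G u).toReal * kRho z z' ^ α := by
  rcases eq_or_ne z z' with rfl | hne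
  · rw [sub_self, abs_zero]
    exact mul_nonneg ENNReal.toReal_nonneg (Real.rpow_nonneg (kRho_nonneg _ _) _)
  · have hle : ENNReal.ofReal (‖u z - u z'‖ / kRho z z' ^ α) ≤ kSemi α G u :=
      le_iSup₂_of_le z hz (le_iSup₂_of_le z' hz' (le_iSup_of_le hne le_rfl))
    rw [ENNReal.ofReal_le_iff_le_toReal hfin,
      div_le_iff₀ (Real.rpow_pos_of_pos (kRho_pos hne) _)] at hle
    exact hle

theorem oscL2_le_campSemi (hfin : campSemi α T u ≠ ∞) {r : ℝ} (hr : 0 < r) {z0 : Pt d}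
    (hz : (z0.1 : EReal) ≤ T) : oscL2 (kQ r z0) u ≤ (campSemi α T u).toReal * r ^ α := by
  have hle : ENNReal.ofReal (oscL2 (kQ r z0) u / r ^ α) ≤ campSemi α T u :=
    le_iSup₂_of_le r hr (le_iSup₂_of_le z0 hz le_rfl)
  rwa [ENNReal.ofReal_le_iff_le_toReal hfin, div_le_iff₀ (Real.rpow_pos_of_pos hr _)] at hle

theorem two_mul_rpow_le {r : ℝ} (hα : α ∈ Ioc (0 : ℝ) 1) (hr : 0 ≤ r) :
    (2 * r) ^ α ≤ 2 * r ^ α := by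
  rw [Real.mul_rpow two_pos.le hr]
  gcongr
  simpa using Real.rpow_le_rpow_of_exponent_le one_le_two hα.2

theorem campSemi_le (hα : α ∈ Ioc (0 : ℝ) 1) {N : ℝ} (hN : 2 ≤ N)
    (hui : ∀ z0 : Pt d, (z0.1 : EReal) ≤ T → ∀ r : ℝ, 0 < r → IntegrableOn u (kQ r z0))
    (hu2 : ∀ z0 : Pt d, (z0.1 : EReal) ≤ T → ∀ r : ℝ, 0 < r →
      IntegrableOn (fun z => u z ^ 2) (kQ r z0)) :
    campSemi α T u ≤ ENNReal.ofReal N * kSemi α (slabG d T) u := by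
  rcases eq_or_ne (kSemi α (slabG d T) u) ∞ with htop | hfin
  · rw [htop, ENNReal.mul_top (by simpa using by linarith)]
    exact le_top
  refine iSup₂_le fun r hr => iSup₂_le fun z0 hz0 => ?_
  rw [← ENNReal.ofReal_toReal hfin, ← ENNReal.ofReal_mul (by linarith)]
  set C := (kSemi α (slabG d T) u).toReal
  have hC : 0 ≤ C := ENNReal.toReal_nonneg
  have hrα : 0 < r ^ α := Real.rpow_pos_of_pos hr _
  refine ENNReal.ofReal_le_ofReal ((div_le_iff₀ hrα).2 ?_)
  refine (oscL2_kQ_le (D := C * (2 * r ^ α)) hr (by positivity) (hui z0 hz0 r hr)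
    (hu2 z0 hz0 r hr) fun z hz z' hz' => ?_).trans ?_
  · refine (abs_sub_le_kSemi hfin (kQ_subset_slabG hz0 r hz)
      (kQ_subset_slabG hz0 r hz')).trans ?_
    gcongr
    exact (Real.rpow_le_rpow (kRho_nonneg _ _) (kRho_le_of_mem_kQ hz hz') hα.1.le).trans
      (two_mul_rpow_le hα hr.le)
  · nlinarith [mul_nonneg hC hrα.le]

theorem abs_avg_sub_avg_le (hfin : campSemi α T u ≠ ∞) {r : ℝ} (hr : 0 < r) {z1 z2 : Pt d}
    (hz2 : (z2.1 : EReal) ≤ T) (hsub : kQ r z1 ⊆ kQ (2 * r) z2)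
    (hui : ∀ z0 : Pt d, (z0.1 : EReal) ≤ T → ∀ r : ℝ, 0 < r → IntegrableOn u (kQ r z0))
    (hu2 : ∀ z0 : Pt d, (z0.1 : EReal) ≤ T → ∀ r : ℝ, 0 < r →
      IntegrableOn (fun z => u z ^ 2) (kQ r z0)) :
    |avg (kQ r z1) u - avg (kQ (2 * r) z2) u| ≤
      √(2 ^ (2 + 4 * d)) * ((campSemi α T u).toReal * (2 * r) ^ α) := by
  have h2r : 0 < 2 * r := by positivity
  refine (abs_setAverage_sub_le hsub (volume_real_kQ_pos hr z1) (volume_kQ_ne_top h2r z2)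
    (volume_real_kQ_two_mul hr z1 z2).le (hui z2 hz2 _ h2r) (hu2 z2 hz2 _ h2r)).trans ?_
  gcongr
  exact oscL2_le_campSemi hfin h2r hz2

/-- The average over a cylinder is close to the value at its vertex, by summing the differences
of the averages over dyadically shrinking cylinders. -/
theorem abs_avg_sub_apply_le (hα : 0 < α) (hfin : campSemi α T u ≠ ∞) {r : ℝ} (hr : 0 < r)
    {z0 : Pt d} (hz0 : (z0.1 : EReal) ≤ T) (hcont : ContinuousAt u z0)
    (hui : ∀ z0 : Pt d, (z0.1 : EReal) ≤ T → ∀ r : ℝ, 0 < r → IntegrableOn u (kQ r z0))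
    (hu2 : ∀ z0 : Pt d, (z0.1 : EReal) ≤ T → ∀ r : ℝ, 0 < r →
      IntegrableOn (fun z => u z ^ 2) (kQ r z0)) :
    |avg (kQ r z0) u - u z0| ≤
      √(2 ^ (2 + 4 * d)) * ((campSemi α T u).toReal * r ^ α) / (1 - (1 / 2) ^ α) := by
  have hratio : ((1 : ℝ) / 2) ^ α < 1 := Real.rpow_lt_one (by norm_num) (by norm_num) hα
  have hlim : Tendsto (fun n : ℕ => r * (1 / 2) ^ n) atTop (𝓝 0) := by
    simpa using (tendsto_pow_atTop_nhds_zero_of_lt_one (r := (1 / 2 : ℝ)) (by norm_num)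
      (by norm_num)).const_mul r
  have htend : Tendsto (fun n : ℕ => avg (kQ (r * (1 / 2) ^ n) z0) u) atTop (𝓝 (u z0)) := by
    refine Metric.tendsto_nhds.2 fun ε hε => ?_
    obtain ⟨s, hs, hsub⟩ := exists_forall_kQ_subset
      (hcont (Metric.closedBall_mem_nhds (u z0) (half_pos hε)))
    filter_upwards [hlim.eventually (gt_mem_nhds hs)] with n hn
    have hrn : 0 < r * (1 / 2) ^ n := by positivity
    exact (abs_avg_sub_le hrn (hui z0 hz0 _ hrn) fun z hz => hsub _ hn hz).trans_lt
      (half_lt_self hε)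
  have hstep : ∀ n : ℕ, dist (avg (kQ (r * (1 / 2) ^ n) z0) u)
      (avg (kQ (r * (1 / 2) ^ (n + 1)) z0) u) ≤
        √(2 ^ (2 + 4 * d)) * ((campSemi α T u).toReal * r ^ α) * ((1 / 2) ^ α) ^ n := by
    intro n
    have hrn : 0 < r * (1 / 2) ^ (n + 1) := by positivity
    have htwo : 2 * (r * (1 / 2) ^ (n + 1)) = r * (1 / 2) ^ n := by ring
    have h := abs_avg_sub_avg_le hfin hrn hz0
      (kQ_subset_kQ_two_mul (z1 := z0) (z2 := z0) le_rfl (by rw [sub_self]; positivity)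
        (by rw [sub_self, norm_zero]; positivity)
        (by rw [sub_self, sub_self, zero_smul, add_zero, norm_zero]; positivity)) hui hu2
    rw [htwo, Real.mul_rpow hr.le (by positivity), ← Real.rpow_pow_comm (by norm_num)] at h
    rw [dist_comm, Real.dist_eq]
    linarith
  simpa [Real.dist_eq] using dist_le_of_le_geometric_of_tendsto₀ _ _ hratio hstep htend

theorem abs_sub_le_campSemi (hα : α ∈ Ioc (0 : ℝ) 1) (hfin : campSemi α T u ≠ ∞) {r : ℝ}
    (hr : 0 < r) {z1 z2 : Pt d} (h1 : z1 ∈ slabG d T) (h2 : z2 ∈ slabG d T)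
    (hcont : ContinuousOn u (slabG d T)) (hsub : kQ r z1 ⊆ kQ (2 * r) z2)
    (hsub' : kQ r z2 ⊆ kQ (2 * r) z2)
    (hui : ∀ z0 : Pt d, (z0.1 : EReal) ≤ T → ∀ r : ℝ, 0 < r → IntegrableOn u (kQ r z0))
    (hu2 : ∀ z0 : Pt d, (z0.1 : EReal) ≤ T → ∀ r : ℝ, 0 < r →
      IntegrableOn (fun z => u z ^ 2) (kQ r z0)) :
    |u z1 - u z2| ≤ (2 * √(2 ^ (2 + 4 * d)) / (1 - (1 / 2) ^ α) + 4 * √(2 ^ (2 + 4 * d))) *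
      (campSemi α T u).toReal * r ^ α := by
  have hz1 : (z1.1 : EReal) ≤ T := le_of_lt h1.1
  have hz2 : (z2.1 : EReal) ≤ T := le_of_lt h2.1
  have e1 := abs_avg_sub_apply_le hα.1 hfin hr hz1
    (hcont.continuousAt ((isOpen_slabG d T).mem_nhds h1)) hui hu2
  have e2 := abs_avg_sub_apply_le hα.1 hfin hr hz2
    (hcont.continuousAt ((isOpen_slabG d T).mem_nhds h2)) hui hu2
  have e3 := abs_avg_sub_avg_le hfin hr hz2 hsub hui hu2
  have e4 := abs_avg_sub_avg_le hfin hr hz2 hsub' hui hu2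
  have e5 : √(2 ^ (2 + 4 * d)) * ((campSemi α T u).toReal * (2 * r) ^ α) ≤
      √(2 ^ (2 + 4 * d)) * ((campSemi α T u).toReal * (2 * r ^ α)) := by
    gcongr
    exact two_mul_rpow_le hα hr.le
  have e6 : (2 * √(2 ^ (2 + 4 * d)) / (1 - (1 / 2) ^ α) + 4 * √(2 ^ (2 + 4 * d))) *
      (campSemi α T u).toReal * r ^ α =
      2 * (√(2 ^ (2 + 4 * d)) * ((campSemi α T u).toReal * r ^ α) / (1 - (1 / 2) ^ α)) +
      2 * (√(2 ^ (2 + 4 * d)) * ((campSemi α T u).toReal * (2 * r ^ α))) := by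
    ring
  rw [e6]
  rw [abs_le] at e1 e2 e3 e4 ⊢
  constructor <;> linarith [e1.1, e1.2, e2.1, e2.2, e3.1, e3.2, e4.1, e4.2]

theorem kSemi_le (hα : α ∈ Ioc (0 : ℝ) 1) {N : ℝ}
    (hN : 2 * √(2 ^ (2 + 4 * d)) / (1 - (1 / 2) ^ α) + 4 * √(2 ^ (2 + 4 * d)) ≤ N)
    (hfin : campSemi α T u ≠ ∞) (hcont : ContinuousOn u (slabG d T))
    (hui : ∀ z0 : Pt d, (z0.1 : EReal) ≤ T → ∀ r : ℝ, 0 < r → IntegrableOn u (kQ r z0))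
    (hu2 : ∀ z0 : Pt d, (z0.1 : EReal) ≤ T → ∀ r : ℝ, 0 < r →
      IntegrableOn (fun z => u z ^ 2) (kQ r z0)) :
    kSemi α (slabG d T) u ≤ ENNReal.ofReal N * campSemi α T u := by
  refine iSup₂_le fun z hz => iSup₂_le fun z' hz' => iSup_le fun hne => ?_
  have hr : 0 < kRho z z' := kRho_pos hne
  rw [← ENNReal.ofReal_toReal hfin, ← ENNReal.ofReal_mul' ENNReal.toReal_nonneg]
  refine ENNReal.ofReal_le_ofReal ((div_le_iff₀ (Real.rpow_pos_of_pos hr _)).2 ?_)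
  have ht := abs_time_sub_le_kRho_sq z z'
  have hx := norm_position_sub_le_kRho_cube z z'
  have hv := norm_velocity_sub_le_kRho z z'
  set r := kRho z z'
  have hself : ∀ z0 : Pt d, kQ r z0 ⊆ kQ (2 * r) z0 := fun z0 =>
    kQ_subset_kQ_two_mul le_rfl (by rw [sub_self]; positivity)
      (by rw [sub_self, norm_zero]; positivity)
      (by rw [sub_self, sub_self, zero_smul, add_zero, norm_zero]; positivity)
  have hmain : |u z - u z'| ≤
      (2 * √(2 ^ (2 + 4 * d)) / (1 - (1 / 2) ^ α) + 4 * √(2 ^ (2 + 4 * d))) *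
        (campSemi α T u).toReal * r ^ α := by
    rcases le_total z.1 z'.1 with hle | hle
    · refine abs_sub_le_campSemi hα hfin hr hz hz' hcont
        (kQ_subset_kQ_two_mul hle ?_ hv ?_) (hself z') hui hu2
      · linarith [(abs_le.1 ht).1]
      · linarith [pow_pos hr 3]
    · rw [abs_sub_comm]
      refine abs_sub_le_campSemi hα hfin hr hz' hz hcont
        (kQ_subset_kQ_two_mul hle ?_ (by rwa [norm_sub_rev]) ?_) (hself z) hui hu2
      · exact (abs_le.1 ht).2
      · have hsplit : z'.2.1 - z.2.1 + (z'.1 - z.1) • z.2.2 =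
            -(z.2.1 - z'.2.1 + (z.1 - z'.1) • z'.2.2) - (z.1 - z'.1) • (z.2.2 - z'.2.2) := by
          module
        have hdrift : ‖(z.1 - z'.1) • (z.2.2 - z'.2.2)‖ ≤ r ^ 2 * r := by
          rw [norm_smul]
          exact mul_le_mul ht hv (norm_nonneg _) (by positivity)
        rw [hsplit]
        refine (norm_sub_le _ _).trans ?_
        rw [norm_neg]
        linarith [pow_succ r 2]
  refine hmain.trans ?_
  gcongr

end Campanato

open MeasureTheory ENNReal Set in
/-- **Lemma 2.1**: equivalence of the kinetic Campanato and kinetic Hölder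
seminorms. -/
theorem campanato_holder_equiv (d : ℕ) (hd : 1 ≤ d) (α : ℝ) (hα : α ∈ Set.Ioc (0:ℝ) 1) :
    ∃ N : ℝ, 0 < N ∧
      ∀ T : EReal, ⊥ < T → ∀ u : Pt d → ℝ,
        ContinuousOn u (slabG d T) →
        (∀ z0 : Pt d, (z0.1 : EReal) ≤ T → ∀ r : ℝ, 0 < r →
          IntegrableOn (fun z => u z ^ 2) (kQ r z0)) →
        campSemi α T u ≤ ENNReal.ofReal N * kSemi α (slabG d T) u ∧
        (campSemi α T u < ⊤ →
          kSemi α (slabG d T) u ≤ ENNReal.ofReal N * campSemi α T u) := by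
  set M : ℝ := √(2 ^ (2 + 4 * d))
  have hratio : ((1 : ℝ) / 2) ^ α < 1 := Real.rpow_lt_one (by norm_num) (by norm_num) hα.1
  have hK : 0 ≤ 2 * M / (1 - (1 / 2) ^ α) + 4 * M :=
    add_nonneg (div_nonneg (by positivity) (sub_nonneg.2 hratio.le)) (by positivity)
  refine ⟨2 * M / (1 - (1 / 2) ^ α) + 4 * M + 2, by linarith, fun T _ u hcont hu2 => ?_⟩
  have hui : ∀ z0 : Pt d, (z0.1 : EReal) ≤ T → ∀ r : ℝ, 0 < r → IntegrableOn u (kQ r z0) :=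
    fun z0 hz0 r hr => integrableOn_of_sq (volume_kQ_ne_top hr z0)
      ((hcont.mono (kQ_subset_slabG hz0 r)).aestronglyMeasurable (isOpen_kQ r z0).measurableSet)
      (hu2 z0 hz0 r hr)
  exact ⟨campSemi_le hα (by linarith) hui hu2,
    fun hfin => kSemi_le hα (by linarith) hfin.ne hcont hui hu2⟩
end

section
/- Anisotropic Hölder regularity plus bounded transport derivative implies kinetic Hölder regularity (Lemma 5.1). Let d ≥ 1, α ∈ (0,1], T ∈ (−∞,∞], and let u : ℝ^{1+2d}_T → ℝ be bounded, with classical partial derivatives ∂_t u and D_x u existing everywhere, such that [u]_{L∞C^{α/3,α}_{x,v}(ℝ^{1+2d}_T)} < ∞ and ‖∂_t u − v·D_x u‖_{L∞(ℝ^{1+2d}_T)} < ∞. Then u ∈ kC^α(ℝ^{1+2d}_T), and for every ε > 0: [u]_{kC^α(ℝ^{1+2d}_T)} ≤ 2 [u]_{L∞C^{α/3,α}_{x,v}(ℝ^{1+2d}_T)} + ε^{2−α} ‖∂_t u − v·D_x u‖_{L∞(ℝ^{1+2d}_T)} + 2 ε^{−α} ‖u‖_{L∞(ℝ^{1+2d}_T)}.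 -/
open MeasureTheory ENNReal Set

/-- One-sided mean value inequality along the diagonal through `p`, locally near `p` and within
the strip `[a, b] × ℝ`. -/
def DiagBoundNear (f : ℝ × ℝ → ℝ) (a b C : ℝ) (p : ℝ × ℝ) : Prop :=
  ∃ r > 0, ∀ c s s' : ℝ, a ≤ s → s ≤ s' → s' ≤ b → (s, c - s) ∈ Metric.ball p r →
    (s', c - s') ∈ Metric.ball p r → f (s', c - s') - f (s, c - s) ≤ C * (s' - s)

lemma isOpen_diagBoundNear (f : ℝ × ℝ → ℝ) (a b C : ℝ) :
    IsOpen {p | DiagBoundNear f a b C p} := by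
  rw [Metric.isOpen_iff]
  rintro p ⟨r, hr, h⟩
  refine ⟨r / 2, by positivity, fun q hq => ⟨r / 2, by positivity, ?_⟩⟩
  have hsub : Metric.ball q (r / 2) ⊆ Metric.ball p r := by
    apply Metric.ball_subset_ball'
    have := Metric.mem_ball.1 hq
    linarith
  intro c s s' h1 h2 h3 h4 h5
  exact h c s s' h1 h2 h3 (hsub h4) (hsub h5)

/-- A function whose lower right Dini derivative is at most `C` grows at rate at most `C`. -/
lemma sub_le_of_frequently_slope_lt {φ : ℝ → ℝ} {s s' C : ℝ} (hs : s ≤ s')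
    (hφ : ContinuousOn φ (Icc s s'))
    (h : ∀ x ∈ Ico s s', ∀ r, C < r → ∃ᶠ z in nhdsWithin x (Ioi x), slope φ x z < r) :
    φ s' - φ s ≤ C * (s' - s) := by
  have hB : ∀ x, HasDerivAt (fun z => φ s + C * (z - s)) C x := fun x => by
    simpa using (((hasDerivAt_id x).sub_const s).const_mul C).const_add (φ s)
  have := image_le_of_liminf_slope_right_le_deriv_boundary hφ
    (B := fun z => φ s + C * (z - s)) (B' := fun _ => C) (by simp)
    (fun x _ => (hB x).continuousAt.continuousWithinAt)
    (fun x _ => (hB x).hasDerivWithinAt) h (right_mem_Icc.2 hs)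
  linarith

lemma slope_lt_of_sub_le {φ : ℝ → ℝ} {x z C r : ℝ} (hxz : x < z)
    (h : φ z - φ x ≤ C * (z - x)) (hr : C < r) : slope φ x z < r := by
  rw [slope_def_field, div_lt_iff₀ (by linarith)]
  have : 0 < z - x := by linarith
  nlinarith

lemma DiagBoundNear.eventually_slope_lt {f : ℝ × ℝ → ℝ} {a b C c x r : ℝ}
    (h : DiagBoundNear f a b C (x, c - x)) (hx : x ∈ Ico a b) (hr : C < r) :
    ∀ᶠ z in nhdsWithin x (Ioi x), slope (fun s => f (s, c - s)) x z < r := by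
  obtain ⟨δ, hδ, h⟩ := h
  have hcont : ContinuousAt (fun s : ℝ => ((s, c - s) : ℝ × ℝ)) x := by fun_prop
  have hball := hcont.eventually (Metric.ball_mem_nhds (x, c - x) hδ)
  filter_upwards [Ioo_mem_nhdsGT hx.2, hball.filter_mono nhdsWithin_le_nhds] with z hz hzb
  exact slope_lt_of_sub_le hz.1
    (h c x z hx.1 hz.1.le hz.2.le (Metric.mem_ball_self hδ) hzb) hr

lemma continuousOn_diag {f : ℝ × ℝ → ℝ} {a b : ℝ}
    (hf : ContinuousOn f (Icc a b ×ˢ univ)) (c : ℝ) :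
    ContinuousOn (fun s => f (s, c - s)) (Icc a b) :=
  hf.comp (f := fun s : ℝ => ((s, c - s) : ℝ × ℝ)) (by fun_prop) fun s hs => ⟨hs, mem_univ _⟩

/-- The local bounds along a diagonal add up, provided they are only missing at the left end. -/
lemma diag_sub_le_of_Ioo {f : ℝ × ℝ → ℝ} {a b C c s s' : ℝ}
    (hf : ContinuousOn f (Icc a b ×ˢ univ)) (ha : a ≤ s) (hs : s < s') (hb : s' ≤ b)
    (h : ∀ x ∈ Ioo s s', DiagBoundNear f a b C (x, c - x)) :
    f (s', c - s') - f (s, c - s) ≤ C * (s' - s) := by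
  have hφ := continuousOn_diag hf c
  have key : ∀ x ∈ Ioo s s', f (s', c - s') - f (x, c - x) ≤ C * (s' - x) := by
    intro x hx
    refine sub_le_of_frequently_slope_lt (φ := fun s => f (s, c - s)) hx.2.le
      (hφ.mono (Icc_subset_Icc (ha.trans hx.1.le) hb)) fun y hy r hr => ?_
    exact ((h y ⟨hx.1.trans_le hy.1, hy.2⟩).eventually_slope_lt
      ⟨by linarith [hx.1, hy.1], by linarith [hy.2]⟩ hr).frequently
  have hmono : nhdsWithin s (Ioo s s') ≤ nhdsWithin s (Icc a b) :=
    nhdsWithin_mono _ fun x hx => ⟨by linarith [hx.1], by linarith [hx.2]⟩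
  have ht : Filter.Tendsto (fun x => f (x, c - x)) (nhdsWithin s (Ioo s s'))
      (nhds (f (s, c - s))) := (hφ s ⟨ha, by linarith⟩).mono_left hmono
  have : (nhdsWithin s (Ioo s s')).NeBot := by
    rw [nhdsWithin_Ioo_eq_nhdsGT hs]; infer_instance
  refine le_of_tendsto_of_tendsto (tendsto_const_nhds.sub ht)
    (((continuous_const.mul (continuous_const.sub continuous_id)).tendsto s).mono_left
      nhdsWithin_le_nhds) ?_
  filter_upwards [self_mem_nhdsWithin] with x hx
  exact key x hx

/-- If both partial difference quotients are uniformly controlled at the bad points near `p`,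
then `p` is not bad. -/
lemma diagBoundNear_of_uniform {f : ℝ × ℝ → ℝ} {a b C α β ε δ r : ℝ} {p : ℝ × ℝ}
    (hf : ContinuousOn f (Icc a b ×ˢ univ)) (hδ : 0 < δ) (hr : 0 < r)
    (hC : α - β + 2 * ε ≤ C)
    (h1 : ∀ q ∈ Metric.ball p r, q.1 ∈ Icc a b → ¬ DiagBoundNear f a b C q →
      ∀ s' ∈ Icc a b, |s' - q.1| < δ → |f (s', q.2) - f q - α * (s' - q.1)| ≤ ε * |s' - q.1|)
    (h2 : ∀ q ∈ Metric.ball p r, q.1 ∈ Icc a b → ¬ DiagBoundNear f a b C q →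
      ∀ y', |y' - q.2| < δ → |f (q.1, y') - f q - β * (y' - q.2)| ≤ ε * |y' - q.2|) :
    DiagBoundNear f a b C p := by
  refine ⟨min r (δ / 2), by positivity, fun c s s' ha hs hb hsp hsp' => ?_⟩
  have hmem : ∀ x ∈ Icc s s', (x, c - x) ∈ Metric.ball p (min r (δ / 2)) := by
    intro x hx
    simp only [Metric.mem_ball, Prod.dist_eq, Real.dist_eq, max_lt_iff, abs_lt] at hsp hsp' ⊢
    obtain ⟨hx1, hx2⟩ := hx
    refine ⟨⟨?_, ?_⟩, ?_, ?_⟩ <;> linarith [hsp.1.1, hsp.1.2, hsp.2.1, hsp.2.2, hsp'.1.1,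
      hsp'.1.2, hsp'.2.1, hsp'.2.2]
  have hdist : s' - s < δ := by
    have h3 := hmem s ⟨le_rfl, hs⟩
    have h4 := hmem s' ⟨hs, le_rfl⟩
    simp only [Metric.mem_ball, Prod.dist_eq, Real.dist_eq, max_lt_iff, abs_lt] at h3 h4
    have := min_le_right r (δ / 2)
    linarith [h3.1.1, h4.1.2]
  have hballr : ∀ x ∈ Icc s s', (x, c - x) ∈ Metric.ball p r := fun x hx =>
    Metric.ball_subset_ball (min_le_left _ _) (hmem x hx)
  refine sub_le_of_frequently_slope_lt (φ := fun s => f (s, c - s)) hs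
    ((continuousOn_diag hf c).mono (Icc_subset_Icc ha hb)) fun x hx ρ hρ => ?_
  have hxab : x ∈ Ico a b := ⟨ha.trans hx.1, hx.2.trans_le hb⟩
  by_cases hgood : DiagBoundNear f a b C (x, c - x)
  · exact (hgood.eventually_slope_lt hxab hρ).frequently
  by_cases hfreq : ∃ᶠ z in nhdsWithin x (Ioi x), ¬ DiagBoundNear f a b C (z, c - z)
  · refine (hfreq.and_eventually (Ioo_mem_nhdsGT hx.2)).mono ?_
    rintro z ⟨hz, hxz, hzs⟩
    refine slope_lt_of_sub_le hxz ?_ hρ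
    have hpos : 0 < z - x := by linarith
    have hzab : z ∈ Icc a b := ⟨by linarith [hxab.1], by linarith⟩
    have e1 := h1 (x, c - x) (hballr x ⟨hx.1, hx.2.le⟩) ⟨hxab.1, hxab.2.le⟩ hgood z hzab
      (by rw [abs_of_pos hpos]; linarith [hx.1])
    have e2 := h2 (z, c - z) (hballr z ⟨by linarith [hx.1], hzs.le⟩) hzab hz (c - x)
      (by rw [abs_of_pos] <;> simp only <;> linarith [hx.1])
    have hsub : c - x - (c - z) = z - x := by ring
    simp only [hsub, abs_of_pos hpos] at e1 e2
    have := (abs_le.1 e1).2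
    have := (abs_le.1 e2).1
    nlinarith [mul_le_mul_of_nonneg_right hC hpos.le]
  · have hev : ∀ᶠ z in nhdsWithin x (Ioi x), DiagBoundNear f a b C (z, c - z) :=
      (Filter.not_frequently.1 hfreq).mono fun _ => not_not.1
    obtain ⟨τ, hτ, hτg⟩ := mem_nhdsGT_iff_exists_Ioo_subset.1 hev
    refine Filter.Eventually.frequently ?_
    filter_upwards [Ioo_mem_nhdsGT hx.2, Ioo_mem_nhdsGT hτ] with z hz hz'
    refine slope_lt_of_sub_le hz.1 ?_ hρ
    exact diag_sub_le_of_Ioo hf hxab.1 hz.1 (hz.2.le.trans hb)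
      fun y hy => hτg ⟨hy.1, hy.2.trans hz'.2⟩

lemma HasDerivWithinAt.exists_forall_abs_sub_le {g : ℝ → ℝ} {g' x α ε : ℝ} {S : Set ℝ}
    (hg : HasDerivWithinAt g g' S x) (hα : |g' - α| < ε) :
    ∃ δ > 0, ∀ y ∈ S, |y - x| < δ → |g y - g x - α * (y - x)| ≤ ε * |y - x| := by
  have h := hg.isLittleO.def (sub_pos.2 hα)
  obtain ⟨δ, hδ, h⟩ := Metric.mem_nhdsWithin_iff.1 h
  refine ⟨δ, hδ, fun y hy hyx => ?_⟩
  have h1 : |g y - g x - (y - x) * g'| ≤ (ε - |g' - α|) * |y - x| := by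
    simpa using h ⟨by simpa [Real.dist_eq] using hyx, hy⟩
  calc |g y - g x - α * (y - x)|
      = |(g y - g x - (y - x) * g') + (g' - α) * (y - x)| := by ring_nf
    _ ≤ (ε - |g' - α|) * |y - x| + |g' - α| * |y - x| :=
        (abs_add_le _ _).trans (add_le_add h1 (abs_mul _ _).le)
    _ = ε * |y - x| := by ring

lemma isClosed_uniform_quotient_bounds {f : ℝ × ℝ → ℝ} {a b : ℝ} {F : Set (ℝ × ℝ)}
    (hFs : F ⊆ Icc a b ×ˢ univ) (hf : ContinuousOn f (Icc a b ×ˢ univ))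
    (α β ε δ : ℝ) :
    IsClosed {q : F | (∀ s' ∈ Icc a b, |s' - q.1.1| < δ →
        |f (s', q.1.2) - f q - α * (s' - q.1.1)| ≤ ε * |s' - q.1.1|) ∧
      ∀ y', |y' - q.1.2| < δ →
        |f (q.1.1, y') - f q - β * (y' - q.1.2)| ≤ ε * |y' - q.1.2|} := by
  have hfq : Continuous fun q : F => f q :=
    hf.comp_continuous continuous_subtype_val fun q => hFs q.2
  refine IsClosed.and ?_ ?_
  · simp only [ofPred_forall]
    refine isClosed_iInter fun s' => isClosed_iInter fun hs' => ?_
    have hfs : Continuous fun q : F => f (s', q.1.2) :=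
      hf.comp_continuous (by fun_prop) fun q => ⟨hs', mem_univ _⟩
    refine isClosed_imp ?_ ?_
    · exact isOpen_lt (by fun_prop) continuous_const
    · exact isClosed_le ((hfs.sub hfq).sub (by fun_prop)).abs (by fun_prop)
  · simp only [ofPred_forall]
    refine isClosed_iInter fun y' => ?_
    have hfs : Continuous fun q : F => f (q.1.1, y') :=
      hf.comp_continuous (by fun_prop) fun q => ⟨(hFs q.2).1, mem_univ _⟩
    refine isClosed_imp ?_ ?_
    · exact isOpen_lt (by fun_prop) continuous_const
    · exact isClosed_le ((hfs.sub hfq).sub (by fun_prop)).abs (by fun_prop)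

/-- One-sided mean value inequality along characteristics for functions that are only continuous
and separately differentiable. The chain rule is not available; the proof is a Baire category
argument on the set of points near which the inequality fails. -/
theorem diag_sub_le_of_partial_derivs {f f₁ f₂ : ℝ × ℝ → ℝ} {a b M : ℝ} (hab : a ≤ b)
    (hf : ContinuousOn f (Icc a b ×ˢ univ))
    (h1 : ∀ p : ℝ × ℝ, p.1 ∈ Icc a b →
      HasDerivWithinAt (fun s => f (s, p.2)) (f₁ p) (Icc a b) p.1)
    (h2 : ∀ p : ℝ × ℝ, p.1 ∈ Icc a b → HasDerivAt (fun y => f (p.1, y)) (f₂ p) p.2)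
    (hM : ∀ p : ℝ × ℝ, p.1 ∈ Icc a b → f₁ p - f₂ p ≤ M) (c : ℝ) :
    f (b, c - b) - f (a, c - a) ≤ M * (b - a) := by
  have main : ∀ ε > 0, ∀ p : ℝ × ℝ, p.1 ∈ Icc a b → DiagBoundNear f a b (M + 4 * ε) p := by
    intro ε hε
    by_contra! hbad
    obtain ⟨p₀, hp₀, hbad⟩ := hbad
    set F : Set (ℝ × ℝ) := {p | p.1 ∈ Icc a b ∧ ¬ DiagBoundNear f a b (M + 4 * ε) p} with hFdef
    have hF : IsClosed F :=
      (isClosed_Icc.preimage continuous_fst).inter (isOpen_diagBoundNear f a b _).isClosed_compl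
    have hFs : F ⊆ Icc a b ×ˢ univ := fun p hp => ⟨hp.1, mem_univ _⟩
    have : Nonempty F := ⟨⟨p₀, hp₀, hbad⟩⟩
    have : CompleteSpace F := hF.completeSpace_coe
    let A : ℚ × ℚ × ℕ → Set F := fun i =>
      {q | (i.1 : ℝ) - i.2.1 ≤ M + 2 * ε} ∩
      {q : F | (∀ s' ∈ Icc a b, |s' - q.1.1| < 1 / ((i.2.2 : ℝ) + 1) →
        |f (s', q.1.2) - f q - i.1 * (s' - q.1.1)| ≤ ε * |s' - q.1.1|) ∧
      ∀ y', |y' - q.1.2| < 1 / ((i.2.2 : ℝ) + 1) →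
        |f (q.1.1, y') - f q - i.2.1 * (y' - q.1.2)| ≤ ε * |y' - q.1.2|}
    have hA : ∀ i, IsClosed (A i) := fun i =>
      isClosed_const.inter (isClosed_uniform_quotient_bounds hFs hf _ _ _ _)
    have hcover : ⋃ i, A i = univ := by
      refine eq_univ_of_forall fun q => mem_iUnion.2 ?_
      have hq := q.2.1
      obtain ⟨α, hα1, hα2⟩ := exists_rat_btwn (show f₁ q - ε < f₁ q + ε by linarith)
      obtain ⟨β, hβ1, hβ2⟩ := exists_rat_btwn (show f₂ q - ε < f₂ q + ε by linarith)
      obtain ⟨δ₁, hδ₁, e1⟩ := (h1 q hq).exists_forall_abs_sub_le (α := α) (ε := ε)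
        (abs_lt.2 ⟨by linarith, by linarith⟩)
      obtain ⟨δ₂, hδ₂, e2⟩ := (h2 q hq).hasDerivWithinAt (s := univ)
        |>.exists_forall_abs_sub_le (α := β) (ε := ε) (abs_lt.2 ⟨by linarith, by linarith⟩)
      obtain ⟨n, hn⟩ := exists_nat_one_div_lt (lt_min hδ₁ hδ₂)
      have := hM q hq
      refine ⟨(α, β, n), by simp only [mem_ofPred_eq]; linarith, fun s' hs' hlt => ?_,
        fun y' hlt => ?_⟩
      · exact e1 s' hs' (hlt.trans (hn.trans_le (min_le_left _ _)))
      · exact e2 y' (mem_univ _) (hlt.trans (hn.trans_le (min_le_right _ _)))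
    obtain ⟨⟨α, β, n⟩, q₀, hq₀⟩ := nonempty_interior_of_iUnion_of_closed hA hcover
    obtain ⟨r, hr, hball⟩ := Metric.isOpen_iff.1 isOpen_interior q₀ hq₀
    have hsub : ∀ q (hq : q ∈ F), q ∈ Metric.ball q₀.1 r → (⟨q, hq⟩ : F) ∈ A (α, β, n) :=
      fun q hq hqr => interior_subset (hball (show (⟨q, hq⟩ : F) ∈ Metric.ball q₀ r from hqr))
    have hαβ : (α : ℝ) - β ≤ M + 2 * ε := (interior_subset hq₀).1
    refine q₀.2.2 (diagBoundNear_of_uniform (α := α) (β := β) (ε := ε)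
      (δ := 1 / ((n : ℝ) + 1)) hf (by positivity) hr (by linarith) ?_ ?_)
    · intro q hqr hq hqb
      exact (hsub q ⟨hq, hqb⟩ hqr).2.1
    · intro q hqr hq hqb
      exact (hsub q ⟨hq, hqb⟩ hqr).2.2
  rcases hab.eq_or_lt with rfl | hlt
  · simp
  have hε : ∀ ε > 0, f (b, c - b) - f (a, c - a) ≤ (M + 4 * ε) * (b - a) := fun ε hε =>
    diag_sub_le_of_Ioo hf le_rfl hlt le_rfl fun x hx => main ε hε _ ⟨hx.1.le, hx.2.le⟩
  refine le_of_forall_pos_le_add fun η hη => ?_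
  have hba : 0 < b - a := sub_pos.2 hlt
  refine (hε (η / (4 * (b - a))) (by positivity)).trans_eq ?_
  field_simp

/-- A function that is Hölder in the second variable, uniformly in the first, and continuous in
the first variable is jointly continuous. -/
lemma continuousOn_prod_of_modulus {f : ℝ × ℝ → ℝ} {S : Set ℝ} {ω : ℝ → ℝ}
    (hω : Continuous ω) (hω0 : ω 0 = 0)
    (h : ∀ s ∈ S, ∀ y y', |f (s, y) - f (s, y')| ≤ ω (y - y'))
    (hs : ∀ y, ContinuousOn (fun s => f (s, y)) S) :
    ContinuousOn f (S ×ˢ univ) := by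
  rintro ⟨s₀, y₀⟩ ⟨hs₀, -⟩
  have hfst : Filter.Tendsto Prod.fst (nhdsWithin (s₀, y₀) (S ×ˢ (univ : Set ℝ)))
      (nhdsWithin s₀ S) :=
    tendsto_nhdsWithin_iff.2 ⟨continuous_fst.continuousWithinAt,
      by filter_upwards [self_mem_nhdsWithin] with p hp using hp.1⟩
  have t1 : Filter.Tendsto (fun p : ℝ × ℝ => |f (p.1, y₀) - f (s₀, y₀)|)
      (nhdsWithin (s₀, y₀) (S ×ˢ (univ : Set ℝ))) (nhds 0) := by
    simpa using (((hs y₀ s₀ hs₀).tendsto.comp hfst).sub_const (f (s₀, y₀))).abs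
  have t2 : Filter.Tendsto (fun p : ℝ × ℝ => ω (p.2 - y₀))
      (nhdsWithin (s₀, y₀) (S ×ˢ (univ : Set ℝ))) (nhds 0) := by
    have : Continuous fun p : ℝ × ℝ => ω (p.2 - y₀) := by fun_prop
    simpa [hω0] using (this.tendsto (s₀, y₀)).mono_left nhdsWithin_le_nhds
  refine tendsto_iff_dist_tendsto_zero.2 (squeeze_zero' (g := fun p : ℝ × ℝ =>
    ω (p.2 - y₀) + |f (p.1, y₀) - f (s₀, y₀)|) (.of_forall fun _ => dist_nonneg) ?_
    (by simpa using t2.add t1))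
  filter_upwards [self_mem_nhdsWithin] with p hp
  rw [Real.dist_eq]
  exact (abs_sub_le _ _ _).trans (add_le_add_left (h p.1 hp.1 p.2 y₀) _)

/-- Along characteristics, `u` is Lipschitz with constant `sup |∂ₜu - v·Dₓu|`. -/
theorem abs_sub_le_of_Yop_le {d : ℕ} {α H N : ℝ} (hα : 0 < α) {I : Set ℝ} {u : Pt d → ℝ}
    (hdt : ∀ z ∈ I ×ˢ (univ : Set (Ed d × Ed d)),
      DifferentiableAt ℝ (fun s => u (s, z.2.1, z.2.2)) z.1)
    (hdx : ∀ z ∈ I ×ˢ (univ : Set (Ed d × Ed d)),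
      DifferentiableAt ℝ (fun y => u (z.1, y, z.2.2)) z.2.1)
    (hH : ∀ t ∈ I, ∀ p q : Ed d × Ed d,
      |u (t, p) - u (t, q)| ≤ H * (‖p.1 - q.1‖ ^ ((1 : ℝ) / 3) + ‖p.2 - q.2‖) ^ α)
    (hN : ∀ z ∈ I ×ˢ (univ : Set (Ed d × Ed d)), |Yop u z| ≤ N)
    {a b : ℝ} (hab : a ≤ b) (hI : Icc a b ⊆ I) (x v : Ed d) :
    |u (b, x - (b - a) • v, v) - u (a, x, v)| ≤ N * (b - a) := by
  set f : ℝ × ℝ → ℝ := fun p => u (p.1, x + p.2 • v, v)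
  have h1 : ∀ p : ℝ × ℝ, p.1 ∈ Icc a b → HasDerivWithinAt (fun s => f (s, p.2))
      (Dt u (p.1, x + p.2 • v, v)) (Icc a b) p.1 := fun p hp =>
    (hdt (p.1, x + p.2 • v, v) ⟨hI hp, mem_univ _⟩).hasDerivAt.hasDerivWithinAt
  have h2 : ∀ p : ℝ × ℝ, p.1 ∈ Icc a b → HasDerivAt (fun y => f (p.1, y))
      (Dx u (p.1, x + p.2 • v, v) v) p.2 := fun p hp => by
    have hl : HasDerivAt (fun y : ℝ => x + y • v) v p.2 := by
      simpa using ((hasDerivAt_id p.2).smul_const v).const_add x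
    exact (hdx (p.1, x + p.2 • v, v) ⟨hI hp, mem_univ _⟩).hasFDerivAt.comp_hasDerivAt p.2 hl
  have hf : ContinuousOn f (Icc a b ×ˢ univ) := by
    refine continuousOn_prod_of_modulus
      (ω := fun y => H * (‖y • v‖ ^ ((1 : ℝ) / 3)) ^ α) ?_ ?_ ?_ ?_
    · exact continuous_const.mul ((((continuous_id.smul continuous_const).norm).rpow_const
        fun _ => .inr (by norm_num)).rpow_const fun _ => .inr hα.le)
    · simp [Real.zero_rpow hα.ne']
    · intro s hs y y'
      have := hH s (hI hs) (x + y • v, v) (x + y' • v, v)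
      simpa [f, sub_smul] using this
    · exact fun y s hs => (h1 (s, y) hs).continuousWithinAt
  have hY : ∀ p : ℝ × ℝ, p.1 ∈ Icc a b →
      |Dt u (p.1, x + p.2 • v, v) - Dx u (p.1, x + p.2 • v, v) v| ≤ N := fun p hp =>
    hN (p.1, x + p.2 • v, v) ⟨hI hp, mem_univ _⟩
  have up := diag_sub_le_of_partial_derivs hab hf h1 h2 (fun p hp => (abs_le.1 (hY p hp)).2) a
  have low := diag_sub_le_of_partial_derivs hab hf.neg (fun p hp => (h1 p hp).neg)
    (fun p hp => (h2 p hp).neg) (M := N)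
    (fun p hp => by linarith [(abs_le.1 (hY p hp)).1]) a
  have e1 : f (b, a - b) = u (b, x - (b - a) • v, v) := by
    simp only [f, ← neg_sub b a, neg_smul, sub_eq_add_neg]
  have e2 : f (a, a - a) = u (a, x, v) := by simp [f]
  simp only [Pi.neg_apply, e1, e2] at up low
  exact abs_le.2 ⟨by linarith, by linarith⟩

lemma abs_le_toReal_supNorm {d : ℕ} {G : Set (Pt d)} {u : Pt d → ℝ} (hb : supNorm G u < ⊤)
    {z : Pt d} (hz : z ∈ G) : |u z| ≤ (supNorm G u).toReal := by
  have h : (‖u z‖₊ : ℝ≥0∞) ≤ supNorm G u := le_iSup₂_of_le z hz le_rfl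
  simpa using ENNReal.toReal_mono hb.ne h

lemma abs_sub_le_lixvSemi {d : ℕ} {α : ℝ} (hα : 0 < α) {I : Set ℝ} {u : Pt d → ℝ}
    (hsemi : lixvSemi α I univ u < ⊤) {t : ℝ} (ht : t ∈ I) (p q : Ed d × Ed d) :
    |u (t, p) - u (t, q)| ≤
      (lixvSemi α I univ u).toReal * (‖p.1 - q.1‖ ^ ((1 : ℝ) / 3) + ‖p.2 - q.2‖) ^ α := by
  rcases eq_or_ne p q with rfl | hpq
  · simp [Real.zero_rpow hα.ne']
  have h : ENNReal.ofReal (‖u (t, p) - u (t, q)‖ /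
      (‖p.1 - q.1‖ ^ ((1 : ℝ) / 3) + ‖p.2 - q.2‖) ^ α) ≤ lixvSemi α I univ u := by
    refine le_iSup₂_of_le t ht ?_
    exact le_iSup₂_of_le p (mem_univ _) (le_iSup₂_of_le q (mem_univ _) (le_iSup_of_le hpq le_rfl))
  have hpos : 0 < ‖p.1 - q.1‖ ^ ((1 : ℝ) / 3) + ‖p.2 - q.2‖ := by
    by_cases h1 : p.1 = q.1
    · have : p.2 ≠ q.2 := fun h2 => hpq (Prod.ext h1 h2)
      have := norm_pos_iff.2 (sub_ne_zero.2 this)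
      positivity
    · have := norm_pos_iff.2 (sub_ne_zero.2 h1)
      positivity
  have hle := (ENNReal.ofReal_le_iff_le_toReal hsemi.ne).1 h
  rwa [div_le_iff₀ (Real.rpow_pos_of_pos hpos α)] at hle

/-- The pointwise form of the interpolation inequality. -/
lemma abs_sub_le_kRho_rpow {d : ℕ} {α H N S ε : ℝ} (hα : α ∈ Ioc (0 : ℝ) 1) (hε : 0 < ε)
    {I : Set ℝ} (hI : I.OrdConnected) {u : Pt d → ℝ} (hH0 : 0 ≤ H)
    (hN0 : 0 ≤ N) (hS0 : 0 ≤ S)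
    (hdt : ∀ z ∈ I ×ˢ (univ : Set (Ed d × Ed d)),
      DifferentiableAt ℝ (fun s => u (s, z.2.1, z.2.2)) z.1)
    (hdx : ∀ z ∈ I ×ˢ (univ : Set (Ed d × Ed d)),
      DifferentiableAt ℝ (fun y => u (z.1, y, z.2.2)) z.2.1)
    (hH : ∀ t ∈ I, ∀ p q : Ed d × Ed d,
      |u (t, p) - u (t, q)| ≤ H * (‖p.1 - q.1‖ ^ ((1 : ℝ) / 3) + ‖p.2 - q.2‖) ^ α)
    (hN : ∀ z ∈ I ×ˢ (univ : Set (Ed d × Ed d)), |Yop u z| ≤ N)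
    (hS : ∀ z ∈ I ×ˢ (univ : Set (Ed d × Ed d)), |u z| ≤ S)
    {z z' : Pt d} (hz : z.1 ∈ I) (hz' : z'.1 ∈ I) :
    |u z - u z'| ≤ (2 * H + ε ^ (2 - α) * N + 2 * ε ^ (-α) * S) * kRho z z' ^ α := by
  obtain ⟨t, x, v⟩ := z
  obtain ⟨t', x', v'⟩ := z'
  simp only at hz hz'
  set ρ := kRho (t, x, v) (t', x', v') with hρ
  have hρt : |t - t'| ^ ((1 : ℝ) / 2) ≤ ρ := le_max_left _ _
  have hρx : ‖x - (x' - (t - t') • v')‖ ^ ((1 : ℝ) / 3) ≤ ρ := by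
    rw [show x - (x' - (t - t') • v') = x - x' + (t - t') • v' by abel]
    exact (le_max_left _ _).trans (le_max_right _ _)
  have hρv : ‖v - v'‖ ≤ ρ := (le_max_right _ _).trans (le_max_right _ _)
  have hρ0 : 0 ≤ ρ := (norm_nonneg _).trans hρv
  have hεα : 0 < ε ^ (2 - α) := Real.rpow_pos_of_pos hε _
  have hεα' : 0 < ε ^ (-α) := Real.rpow_pos_of_pos hε _
  have hρα : 0 ≤ ρ ^ α := Real.rpow_nonneg hρ0 _
  rcases le_total ε ρ with hερ | hρε
  · have h1 : |u (t, x, v) - u (t', x', v')| ≤ 2 * S :=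
      (abs_sub _ _).trans ((add_le_add (hS _ ⟨hz, mem_univ _⟩) (hS _ ⟨hz', mem_univ _⟩)).trans_eq
        (two_mul S).symm)
    have h2 : 1 ≤ ε ^ (-α) * ρ ^ α := by
      rw [Real.rpow_neg hε.le, ← div_eq_inv_mul, one_le_div (Real.rpow_pos_of_pos hε _)]
      exact Real.rpow_le_rpow hε.le hερ hα.1.le
    have h3 : 0 ≤ (2 * H + ε ^ (2 - α) * N) * ρ ^ α := by positivity
    nlinarith
  · have hA : |u (t, x, v) - u (t, x' - (t - t') • v', v')| ≤ 2 * H * ρ ^ α := by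
      refine (hH t hz (x, v) (x' - (t - t') • v', v')).trans ?_
      have h1 : (‖x - (x' - (t - t') • v')‖ ^ ((1 : ℝ) / 3) + ‖v - v'‖) ^ α ≤ (2 * ρ) ^ α :=
        Real.rpow_le_rpow (by positivity) (by linarith) hα.1.le
      have h2 : (2 * ρ) ^ α ≤ 2 * ρ ^ α := by
        rw [Real.mul_rpow zero_le_two hρ0]
        gcongr
        exact Real.rpow_le_self_of_one_le one_le_two hα.2
      nlinarith [mul_le_mul_of_nonneg_left (h1.trans h2) hH0]
    have hB : |u (t, x' - (t - t') • v', v') - u (t', x', v')| ≤ N * |t - t'| := by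
      rcases le_total t' t with h | h
      · rw [abs_of_nonneg (sub_nonneg.2 h)]
        exact abs_sub_le_of_Yop_le hα.1 hdt hdx hH hN h (hI.out hz' hz) x' v'
      · rw [abs_sub_comm, abs_sub_comm t, abs_of_nonneg (sub_nonneg.2 h)]
        have := abs_sub_le_of_Yop_le hα.1 hdt hdx hH hN h (hI.out hz hz')
          (x' - (t - t') • v') v'
        rwa [show x' - (t - t') • v' - (t' - t) • v' = x' by module] at this
    have hC : |t - t'| ≤ ε ^ (2 - α) * ρ ^ α := by
      have h1 : |t - t'| ≤ ρ ^ 2 := by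
        calc |t - t'| = (|t - t'| ^ ((1 : ℝ) / 2)) ^ 2 := by
              rw [← Real.sqrt_eq_rpow, Real.sq_sqrt (abs_nonneg _)]
          _ ≤ ρ ^ 2 := by gcongr
      have h2 : ρ ^ 2 = ρ ^ (2 - α) * ρ ^ α := by
        rw [← Real.rpow_add_of_nonneg hρ0 (by linarith [hα.2]) hα.1.le, sub_add_cancel]
        exact (Real.rpow_two ρ).symm
      rw [h2] at h1
      refine h1.trans (mul_le_mul_of_nonneg_right ?_ hρα)
      exact Real.rpow_le_rpow hρ0 hρε (by linarith [hα.2])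
    have hD : 0 ≤ 2 * ε ^ (-α) * S * ρ ^ α := by positivity
    have := abs_sub_le (u (t, x, v)) (u (t, x' - (t - t') • v', v')) (u (t', x', v'))
    nlinarith [mul_le_mul_of_nonneg_left hC hN0]

lemma ordConnected_slabI (T : EReal) : (slabI T).OrdConnected :=
  ⟨fun _ _ _ hb _ hx => lt_of_le_of_lt (EReal.coe_le_coe_iff.2 hx.2) hb⟩

open MeasureTheory ENNReal Set in
/-- **Lemma 5.1**: anisotropic Hölder regularity plus a bounded transport derivative
implies kinetic Hölder regularity. -/
theorem aniso_plus_transport_kinetic (d : ℕ) (hd : 1 ≤ d) (α : ℝ)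
    (hα : α ∈ Set.Ioc (0:ℝ) 1) (T : EReal) (hT : ⊥ < T) (u : Pt d → ℝ)
    (hb : supNorm (slabG d T) u < ⊤)
    (hdt : ∀ z ∈ slabG d T, DifferentiableAt ℝ (fun s => u (s, z.2.1, z.2.2)) z.1)
    (hdx : ∀ z ∈ slabG d T, DifferentiableAt ℝ (fun y => u (z.1, y, z.2.2)) z.2.1)
    (hsemi : lixvSemi α (slabI T) Set.univ u < ⊤)
    (hY : supNorm (slabG d T) (Yop u) < ⊤) :
    kSemi α (slabG d T) u < ⊤ ∧
    ∀ ε : ℝ, 0 < ε →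
      kSemi α (slabG d T) u ≤
        2 * lixvSemi α (slabI T) Set.univ u
        + ENNReal.ofReal (ε ^ (2 - α)) * supNorm (slabG d T) (Yop u)
        + ENNReal.ofReal (2 * ε ^ (-α)) * supNorm (slabG d T) u := by
  have hS := fun z hz => abs_le_toReal_supNorm hb (z := z) hz
  have hN := fun z hz => abs_le_toReal_supNorm hY (z := z) hz
  have hH := fun t (ht : t ∈ slabI T) => abs_sub_le_lixvSemi hα.1 hsemi ht
  have key : ∀ ε : ℝ, 0 < ε →
      kSemi α (slabG d T) u ≤
        2 * lixvSemi α (slabI T) Set.univ u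
        + ENNReal.ofReal (ε ^ (2 - α)) * supNorm (slabG d T) (Yop u)
        + ENNReal.ofReal (2 * ε ^ (-α)) * supNorm (slabG d T) u := by
    intro ε hε
    have e1 : 0 ≤ ε ^ (2 - α) := by positivity
    have e2 : 0 ≤ 2 * ε ^ (-α) := by positivity
    have hsum : 2 * lixvSemi α (slabI T) Set.univ u
        + ENNReal.ofReal (ε ^ (2 - α)) * supNorm (slabG d T) (Yop u)
        + ENNReal.ofReal (2 * ε ^ (-α)) * supNorm (slabG d T) u
        = ENNReal.ofReal (2 * (lixvSemi α (slabI T) Set.univ u).toReal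
          + ε ^ (2 - α) * (supNorm (slabG d T) (Yop u)).toReal
          + 2 * ε ^ (-α) * (supNorm (slabG d T) u).toReal) := by
      rw [ENNReal.ofReal_add (by positivity) (by positivity),
        ENNReal.ofReal_add (by positivity) (by positivity), ENNReal.ofReal_mul (q := (lixvSemi _ _ _ _).toReal) zero_le_two,
        ENNReal.ofReal_mul e1, ENNReal.ofReal_mul e2,
        ENNReal.ofReal_toReal hb.ne,
        ENNReal.ofReal_toReal hY.ne, ENNReal.ofReal_toReal hsemi.ne, ENNReal.ofReal_ofNat]
    rw [hsum]
    refine iSup₂_le fun z hz => iSup₂_le fun z' hz' => iSup_le fun _ => ?_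
    refine ENNReal.ofReal_le_ofReal (div_le_of_le_mul₀ ?_ (by positivity) ?_)
    · exact Real.rpow_nonneg ((norm_nonneg _).trans
        ((le_max_right _ _).trans (le_max_right _ _))) _
    · exact abs_sub_le_kRho_rpow hα hε (ordConnected_slabI T) toReal_nonneg toReal_nonneg
        toReal_nonneg hdt hdx hH hN hS hz.1 hz'.1
  refine ⟨(key 1 one_pos).trans_lt ?_, key⟩
  simp only [ENNReal.add_lt_top]
  exact ⟨⟨ENNReal.mul_lt_top (by simp) hsemi, ENNReal.mul_lt_top (by simp) hY⟩,
    ENNReal.mul_lt_top (by simp) hb⟩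
end
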